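/- Fix η ∈ {i, j, k} and let B₁, C₁ and D₁ be quaternion matrices of conformable sizes with D₁ = D₁^{η*}. Set M := R_{B₁}C₁ and S := C₁L_M. Then the matrix equation B₁XB₁^{η*} + C₁YC₁^{η*} = D₁ has a pair of η-Hermitian solutions X = X^{η*}, Y = Y^{η*} if and only if R_M R_{B₁}D₁ = 0 and R_{B₁}D₁(R_{C₁})^{η*} = 0. -/

import Mathlib

open scoped Quaternion Classical
open Matrix

noncomputable section

/-- The four Moore–Penrose conditions for `X` to be the Moore–Penrose inverse of `A`
over the real quaternions. -/
def IsMP {m n : Type*} [Fintype m] [Fintype n]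
    (A : Matrix m n ℍ[ℝ]) (X : Matrix n m ℍ[ℝ]) : Prop :=
  A * X * A = A ∧ X * A * X = X ∧ (A * X)ᴴ = A * X ∧ (X * A)ᴴ = X * A

/-- The Moore–Penrose inverse `A†` of a quaternion matrix (it exists and is unique). -/
def dg {m n : Type*} [Fintype m] [Fintype n]
    (A : Matrix m n ℍ[ℝ]) : Matrix n m ℍ[ℝ] :=
  if h : ∃ X, IsMP A X then h.choose else 0

/-- `L_A = I - A† A`. -/
def lproj {m n : Type*} [Fintype m] [Fintype n] [DecidableEq n]
    (A : Matrix m n ℍ[ℝ]) : Matrix n n ℍ[ℝ] :=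
  1 - dg A * A

/-- `R_A = I - A A†`. -/
def rproj {m n : Type*} [Fintype m] [Fintype n] [DecidableEq m]
    (A : Matrix m n ℍ[ℝ]) : Matrix m m ℍ[ℝ] :=
  1 - A * dg A

/-- `A^{η*} = -η A* η`, entrywise. -/
def etaC (η : ℍ[ℝ]) {m n : Type*} (A : Matrix m n ℍ[ℝ]) : Matrix n m ℍ[ℝ] :=
  Matrix.of fun i j => -η * star (A j i) * η

/-- `η` is one of the quaternion units `i`, `j`, `k`. -/
def IsImUnit (η : ℍ[ℝ]) : Prop :=
  η = ⟨0, 1, 0, 0⟩ ∨ η = ⟨0, 0, 1, 0⟩ ∨ η = ⟨0, 0, 0, 1⟩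

section InnerInverse

variable {m n : Type*} [Fintype m] [Fintype n]

/-- Every linear map between vector spaces over a division ring has an inner inverse. -/
lemma LinearMap.exists_comp_comp_eq_self {K V W : Type*} [DivisionRing K]
    [AddCommGroup V] [Module K V] [AddCommGroup W] [Module K W] (f : V →ₗ[K] W) :
    ∃ g : W →ₗ[K] V, f ∘ₗ g ∘ₗ f = f := by
  obtain ⟨g₀, hg₀⟩ := f.rangeRestrict.exists_rightInverse_of_surjective f.range_rangeRestrict
  obtain ⟨g, hg⟩ := g₀.exists_extend
  refine ⟨g, LinearMap.ext fun v => ?_⟩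
  have h₁ : g (f v) = g₀ (f.rangeRestrict v) := LinearMap.congr_fun hg (f.rangeRestrict v)
  have h₂ := congrArg Subtype.val (LinearMap.congr_fun hg₀ (f.rangeRestrict v))
  change f (g (f v)) = f v
  rw [h₁]
  exact h₂

/-- Matrices over a division ring have inner inverses. -/
lemma Matrix.exists_mul_mul_eq_self {K : Type*} [DivisionRing K] (A : Matrix m n K) :
    ∃ G : Matrix n m K, A * G * A = A := by
  obtain ⟨g, hg⟩ := A.toLinearMapRight'.exists_comp_comp_eq_self
  refine ⟨LinearMap.toMatrixRight' g, Matrix.toLinearMapRight'.injective ?_⟩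
  rw [Matrix.toLinearMapRight'_mul, Matrix.toLinearMapRight'_mul,
    LinearEquiv.symm_apply_apply]
  exact hg

lemma conjTranspose_mul_self_eq_zero_quaternion {k l : Type*} [Fintype k]
    {A : Matrix k l ℍ[ℝ]} (h : Aᴴ * A = 0) : A = 0 := by
  ext1 i j
  have hj := congrFun (congrFun h j) j
  simp only [Matrix.mul_apply, conjTranspose_apply, Quaternion.star_mul_self,
    Matrix.zero_apply] at hj
  have hsum : ∑ r, Quaternion.normSq (A r j) = 0 := by
    apply Quaternion.coe_injective
    rw [← Quaternion.algebraMap_def, map_sum, map_zero]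
    exact hj
  rw [Finset.sum_eq_zero_iff_of_nonneg fun _ _ => Quaternion.normSq_nonneg] at hsum
  exact Quaternion.normSq_eq_zero.mp (hsum i (Finset.mem_univ i))

/-- A `{1, 3}`-inverse of a quaternion matrix. -/
lemma exists_inner_inverse_hermitian_left (A : Matrix m n ℍ[ℝ]) :
    ∃ G : Matrix n m ℍ[ℝ], A * G * A = A ∧ (A * G)ᴴ = A * G := by
  obtain ⟨G, hG⟩ := (Aᴴ * A).exists_mul_mul_eq_self
  have h₁ : A * G * Aᴴ * A = A := by
    rw [← sub_eq_zero]
    apply conjTranspose_mul_self_eq_zero_quaternion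
    have h₀ : Aᴴ * (A * G * Aᴴ * A - A) = 0 := by
      rw [Matrix.mul_sub, sub_eq_zero]
      simpa only [Matrix.mul_assoc] using hG
    rw [conjTranspose_sub, Matrix.sub_mul, h₀]
    simp only [conjTranspose_mul, Matrix.mul_assoc] at h₀ ⊢
    simp only [h₀, conjTranspose_conjTranspose, Matrix.mul_zero, sub_zero]
  have h₂ : Aᴴ * (A * (Gᴴ * Aᴴ)) = Aᴴ := by
    simpa only [conjTranspose_mul, conjTranspose_conjTranspose, Matrix.mul_assoc] using
      congrArg conjTranspose h₁
  refine ⟨G * Aᴴ, by simpa only [Matrix.mul_assoc] using h₁, ?_⟩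
  have h₃ : A * (G * Aᴴ) = A * (Gᴴ * Aᴴ) := by
    calc A * (G * Aᴴ) = A * (G * (Aᴴ * (A * (Gᴴ * Aᴴ)))) := by rw [h₂]
      _ = (A * G * Aᴴ * A) * (Gᴴ * Aᴴ) := by simp only [Matrix.mul_assoc]
      _ = A * (Gᴴ * Aᴴ) := by rw [h₁]
  simpa only [conjTranspose_mul, conjTranspose_conjTranspose, Matrix.mul_assoc] using h₃.symm

/-- Every quaternion matrix has a Moore–Penrose inverse. -/
lemma exists_isMP (A : Matrix m n ℍ[ℝ]) : ∃ X, IsMP A X := by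
  obtain ⟨G, hG, hG'⟩ := exists_inner_inverse_hermitian_left A
  obtain ⟨H, hH, hH'⟩ := exists_inner_inverse_hermitian_left Aᴴ
  have hHA : A * Hᴴ * A = A := by
    simpa only [conjTranspose_mul, conjTranspose_conjTranspose, Matrix.mul_assoc] using
      congrArg conjTranspose hH
  have hHA' : (Hᴴ * A)ᴴ = Hᴴ * A := by
    simpa only [conjTranspose_mul, conjTranspose_conjTranspose] using hH'.symm
  have hl : A * (Hᴴ * A * G) = A * G := by
    rw [← Matrix.mul_assoc, ← Matrix.mul_assoc, hHA]
  have hr : Hᴴ * A * G * A = Hᴴ * A := by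
    rw [Matrix.mul_assoc Hᴴ, Matrix.mul_assoc Hᴴ, hG]
  refine ⟨Hᴴ * A * G, ?_, ?_, ?_, ?_⟩
  · rw [hl, hG]
  · rw [hr, Matrix.mul_assoc, hl, Matrix.mul_assoc]
  · rw [hl, hG']
  · rw [hr, hHA']

lemma mul_dg_mul_self (A : Matrix m n ℍ[ℝ]) : A * dg A * A = A := by
  have h := exists_isMP A
  rw [dg, dif_pos h]
  exact h.choose_spec.1

lemma rproj_mul_self [DecidableEq m] (A : Matrix m n ℍ[ℝ]) : rproj A * A = 0 := by
  rw [rproj, Matrix.sub_mul, Matrix.one_mul, mul_dg_mul_self, sub_self]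

lemma mul_dg_mul_of_rproj_mul_eq_zero {l : Type*} [DecidableEq m] {A : Matrix m n ℍ[ℝ]}
    {B : Matrix m l ℍ[ℝ]} (h : rproj A * B = 0) : A * (dg A * B) = B := by
  rw [rproj, Matrix.sub_mul, Matrix.one_mul, sub_eq_zero, Matrix.mul_assoc] at h
  exact h.symm

end InnerInverse

section EtaC

variable {η : ℍ[ℝ]} {l m n : Type*}

lemma IsImUnit.star_eq (hη : IsImUnit η) : star η = -η := by
  rw [Quaternion.star_eq_neg]
  rcases hη with rfl | rfl | rfl <;> rfl

lemma IsImUnit.normSq_eq_one (hη : IsImUnit η) : Quaternion.normSq η = 1 := by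
  rw [Quaternion.normSq_def']
  rcases hη with rfl | rfl | rfl <;> norm_num

lemma IsImUnit.mul_self (hη : IsImUnit η) : η * η = -1 := by
  have h := Quaternion.star_mul_self (a := η)
  rw [hη.star_eq, hη.normSq_eq_one, Quaternion.coe_one, neg_mul] at h
  rw [← h, neg_neg]

lemma etaC_add (A B : Matrix m n ℍ[ℝ]) : etaC η (A + B) = etaC η A + etaC η B := by
  ext1 i j
  simp only [etaC, Matrix.of_apply, Matrix.add_apply, star_add, mul_add, add_mul]

lemma etaC_sub (A B : Matrix m n ℍ[ℝ]) : etaC η (A - B) = etaC η A - etaC η B := by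
  ext1 i j
  simp only [etaC, Matrix.of_apply, Matrix.sub_apply, star_sub, mul_sub, sub_mul]

lemma etaC_zero : etaC η (0 : Matrix m n ℍ[ℝ]) = 0 := by
  ext1 i j
  simp only [etaC, Matrix.of_apply, Matrix.zero_apply, star_zero, mul_zero, zero_mul]

lemma etaC_etaC (hη : IsImUnit η) (A : Matrix m n ℍ[ℝ]) : etaC η (etaC η A) = A := by
  ext1 i j
  simp only [etaC, Matrix.of_apply, star_mul, star_neg, star_star, hη.star_eq, neg_neg]
  calc -η * (-η * (A i j * η)) * η = (η * η) * A i j * (η * η) := by noncomm_ring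
    _ = A i j := by rw [hη.mul_self]; noncomm_ring

lemma etaC_mul [Fintype m] (hη : IsImUnit η) (A : Matrix l m ℍ[ℝ]) (B : Matrix m n ℍ[ℝ]) :
    etaC η (A * B) = etaC η B * etaC η A := by
  ext1 i j
  simp only [etaC, Matrix.of_apply, Matrix.mul_apply, star_sum, Finset.mul_sum, Finset.sum_mul,
    star_mul]
  refine Finset.sum_congr rfl fun k _ => ?_
  calc -η * (star (B k i) * star (A j k)) * η
      = η * star (B k i) * (-1) * star (A j k) * η := by noncomm_ring
    _ = -η * star (B k i) * η * (-η * star (A j k) * η) := by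
      rw [← hη.mul_self]; noncomm_ring

end EtaC

section Equation

variable {η : ℍ[ℝ]} {l m n : Type*} [Fintype l] [Fintype m] [Fintype n] [DecidableEq l]

lemma mul_etaC_dg_mul_etaC {k : Type*} (hη : IsImUnit η) {A : Matrix l m ℍ[ℝ]}
    {E : Matrix k l ℍ[ℝ]} (h : E * etaC η (rproj A) = 0) :
    E * (etaC η (dg A) * etaC η A) = E := by
  have h' : rproj A * etaC η E = 0 := by
    simpa only [etaC_mul hη, etaC_etaC hη, etaC_zero] using congrArg (etaC η) h
  have := congrArg (etaC η) (mul_dg_mul_of_rproj_mul_eq_zero h')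
  simpa only [etaC_mul hη, etaC_etaC hη, Matrix.mul_assoc] using this

/-- An η-Hermitian matrix annihilated by `R_B` has the form `B X B^{η*}`. -/
lemma exists_etaHermitian_mul_mul_etaC (hη : IsImUnit η) (B : Matrix l m ℍ[ℝ])
    {F : Matrix l l ℍ[ℝ]} (hF : etaC η F = F) (h : rproj B * F = 0) :
    ∃ X : Matrix m m ℍ[ℝ], etaC η X = X ∧ B * X * etaC η B = F := by
  refine ⟨dg B * F * etaC η (dg B), ?_, ?_⟩
  · simp only [etaC_mul hη, etaC_etaC hη, hF, Matrix.mul_assoc]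
  · have h' : F * etaC η (rproj B) = 0 := by
      simpa only [etaC_mul hη, hF, etaC_zero] using congrArg (etaC η) h
    calc B * (dg B * F * etaC η (dg B)) * etaC η B
        = B * (dg B * (F * (etaC η (dg B) * etaC η B))) := by simp only [Matrix.mul_assoc]
      _ = F := by
        rw [mul_etaC_dg_mul_etaC hη h', mul_dg_mul_of_rproj_mul_eq_zero h]

/-- An η-Hermitian solution `Y` of `R C Y C^{η*} = R D`. -/
lemma exists_etaHermitian_solution (hη : IsImUnit η) (R D : Matrix l l ℍ[ℝ])
    (C : Matrix l n ℍ[ℝ]) (hD : etaC η D = D) (h₁ : rproj (R * C) * (R * D) = 0)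
    (h₂ : R * D * etaC η (rproj C) = 0) :
    ∃ Y : Matrix n n ℍ[ℝ], etaC η Y = Y ∧ R * C * Y * etaC η C = R * D := by
  set G := dg (R * C) with hG
  set K := dg C with hK
  have hl : R * (C * (G * (R * D))) = R * D := by
    simpa only [Matrix.mul_assoc] using mul_dg_mul_of_rproj_mul_eq_zero h₁
  have hr : R * (D * (etaC η K * etaC η C)) = R * D := by
    simpa only [Matrix.mul_assoc] using mul_etaC_dg_mul_etaC hη h₂
  have hr' : C * (K * (D * etaC η R)) = D * etaC η R := by
    simpa only [etaC_mul hη, etaC_etaC hη, hD, Matrix.mul_assoc] using congrArg (etaC η) hr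
  refine ⟨G * (R * D) * etaC η K + K * (D * etaC η R) * etaC η G
    - G * (R * D) * etaC η R * etaC η G, ?_, ?_⟩
  · simp only [etaC_add, etaC_sub, etaC_mul hη, etaC_etaC hη, hD, Matrix.mul_assoc]
    abel
  · have e₁ : R * C * (G * (R * D) * etaC η K) * etaC η C = R * D := by
      calc _ = R * (C * (G * (R * D))) * (etaC η K * etaC η C) := by
            simp only [Matrix.mul_assoc]
        _ = R * D := by rw [hl, Matrix.mul_assoc, hr]
    have e₂ : R * C * (K * (D * etaC η R) * etaC η G) * etaC η C
        = R * D * etaC η R * etaC η G * etaC η C := by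
      calc _ = R * (C * (K * (D * etaC η R))) * etaC η G * etaC η C := by
            simp only [Matrix.mul_assoc]
        _ = _ := by rw [hr']; simp only [Matrix.mul_assoc]
    have e₃ : R * C * (G * (R * D) * etaC η R * etaC η G) * etaC η C
        = R * D * etaC η R * etaC η G * etaC η C := by
      calc _ = R * (C * (G * (R * D))) * etaC η R * etaC η G * etaC η C := by
            simp only [Matrix.mul_assoc]
        _ = _ := by rw [hl]
    rw [Matrix.mul_sub, Matrix.mul_add, Matrix.sub_mul, Matrix.add_mul, e₁, e₂, e₃,
      add_sub_cancel_right]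

end Equation

/-- Solvability criterion for `B₁XB₁^{η*} + C₁YC₁^{η*} = D₁`
in η-Hermitian unknowns `X`, `Y`. -/
theorem quat_etaHermitian_pair_equation_solvable_iff
    {p m n : ℕ} (η : ℍ[ℝ]) (hη : IsImUnit η)
    (B₁ : Matrix (Fin p) (Fin m) ℍ[ℝ]) (C₁ : Matrix (Fin p) (Fin n) ℍ[ℝ])
    (D₁ : Matrix (Fin p) (Fin p) ℍ[ℝ]) (hD₁ : D₁ = etaC η D₁) :
    let M := rproj B₁ * C₁
    let S := C₁ * lproj M
    ((∃ (X : Matrix (Fin m) (Fin m) ℍ[ℝ]) (Y : Matrix (Fin n) (Fin n) ℍ[ℝ]),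
        X = etaC η X ∧ Y = etaC η Y ∧
        B₁ * X * etaC η B₁ + C₁ * Y * etaC η C₁ = D₁) ↔
      (rproj M * rproj B₁ * D₁ = 0 ∧ rproj B₁ * D₁ * etaC η (rproj C₁) = 0)) := by
  intro M S
  constructor
  · rintro ⟨X, Y, -, -, rfl⟩
    have hB : rproj B₁ * (B₁ * X * etaC η B₁ + C₁ * Y * etaC η C₁) = M * Y * etaC η C₁ := by
      rw [Matrix.mul_add, Matrix.mul_assoc B₁, ← Matrix.mul_assoc (rproj B₁) B₁, rproj_mul_self,
        Matrix.zero_mul, zero_add]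
      simp only [M, Matrix.mul_assoc]
    constructor
    · rw [Matrix.mul_assoc, hB, Matrix.mul_assoc M, ← Matrix.mul_assoc, rproj_mul_self,
        Matrix.zero_mul]
    · rw [hB, Matrix.mul_assoc, ← etaC_mul hη, rproj_mul_self, etaC_zero, Matrix.mul_zero]
  · rintro ⟨h₁, h₂⟩
    rw [Matrix.mul_assoc] at h₁
    obtain ⟨Y, hY, hYD⟩ := exists_etaHermitian_solution hη (rproj B₁) D₁ C₁ hD₁.symm h₁ h₂
    obtain ⟨X, hX, hXF⟩ := exists_etaHermitian_mul_mul_etaC hη B₁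
      (F := D₁ - C₁ * Y * etaC η C₁)
      (by simp only [etaC_sub, etaC_mul hη, etaC_etaC hη, hY, ← hD₁, Matrix.mul_assoc])
      (by rw [Matrix.mul_sub, ← hYD, sub_eq_zero]; simp only [Matrix.mul_assoc])
    exact ⟨X, Y, hX.symm, hY.symm, by rw [hXF, sub_add_cancel]⟩
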